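/- There exists c > 2/√3 such that h₁(c) + h₂(c) + h₃(c) = π, where h₁(c) = ∫_{π/3}^{2π/3} (1 − R⁻(c·sin ψ)²)⁻¹ dψ, h₃(c) = ∫_{π/3}^{2π/3} (R⁺(c·sin ψ)² − 1)⁻¹ dψ, and h₂(c) = ∫_{R⁻((√3/2)c)}^{R⁺((√3/2)c)} K(R)/(R·√(c² − K(R)²)) dR. (This is the analytic content of the existence of the degenerate 'heart' shrinker: at c = 2/√3 the sum equals the full period T(2/√3) > π, while as c → ∞ it tends to 2π/3, so the intermediate value theorem applies.) -/

import Mathlib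

open Real

noncomputable def K (R : ℝ) : ℝ := Real.exp ((R ^ 2 - 1) / 2) / R

open Set Filter Topology

lemma K_pos {R : ℝ} (hR : 0 < R) : 0 < K R := div_pos (exp_pos _) hR

lemma hasDerivAt_K {R : ℝ} (hR : R ≠ 0) : HasDerivAt K (K R * (R - R⁻¹)) R := by
  have h1 : HasDerivAt (fun R : ℝ => (R ^ 2 - 1) / 2) R R :=
    ((((hasDerivAt_id' R).fun_pow 2).sub_const 1).div_const 2).congr_deriv (by norm_num)
  have h2 := h1.exp.fun_div (hasDerivAt_id' R) hR
  refine h2.congr_deriv ?_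
  rw [K]
  field_simp

lemma continuousOn_K : ContinuousOn K (Ioi 0) := fun _ hR =>
  (hasDerivAt_K (ne_of_gt hR)).continuousAt.continuousWithinAt

lemma strictAntiOn_K : StrictAntiOn K (Ioc 0 1) := by
  refine strictAntiOn_of_deriv_neg (convex_Ioc 0 1) (continuousOn_K.mono fun R hR => hR.1) ?_
  intro R hR
  rw [interior_Ioc] at hR
  rw [(hasDerivAt_K hR.1.ne').deriv]
  have := (one_lt_inv₀ hR.1).2 hR.2
  exact mul_neg_of_pos_of_neg (K_pos hR.1) (by linarith [hR.2])

lemma strictMonoOn_K : StrictMonoOn K (Ici 1) := by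
  refine strictMonoOn_of_deriv_pos (convex_Ici 1)
    (continuousOn_K.mono (Ici_subset_Ioi.2 one_pos)) ?_
  intro R hR
  rw [interior_Ici] at hR
  have hR' : 1 < R := hR
  rw [(hasDerivAt_K (by positivity)).deriv]
  have := inv_lt_one_of_one_lt₀ hR'
  exact mul_pos (K_pos (by linarith)) (by linarith)

lemma exp_eq_of_K_eq {R x : ℝ} (hR : 0 < R) (h : K R = x) :
    exp (R ^ 2 - 1) = x ^ 2 * R ^ 2 := by
  have : exp ((R ^ 2 - 1) / 2) = x * R := by rw [← h, K]; field_simp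
  rw [← mul_pow, ← this, ← exp_nat_mul]
  congr 1
  push_cast
  ring

/-- The branch of the inverse of `K` below `1`. -/
def IsLowerBranch (Rm : ℝ → ℝ) : Prop := ∀ x : ℝ, 1 < x → 0 < Rm x ∧ Rm x < 1 ∧ K (Rm x) = x

/-- The branch of the inverse of `K` above `1`. -/
def IsUpperBranch (Rp : ℝ → ℝ) : Prop := ∀ x : ℝ, 1 < x → 1 < Rp x ∧ K (Rp x) = x

section Branches

variable {Rm Rp : ℝ → ℝ}

lemma IsLowerBranch.lt_iff (h : IsLowerBranch Rm) {x r : ℝ} (hx : 1 < x) (hr : r ∈ Ioc (0 : ℝ) 1) :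
    r < Rm x ↔ x < K r := by
  obtain ⟨h0, h1, h2⟩ := h x hx
  have := strictAntiOn_K.lt_iff_gt ⟨h0, h1.le⟩ hr
  rw [h2] at this
  exact this.symm

lemma IsLowerBranch.lt_iff' (h : IsLowerBranch Rm) {x r : ℝ} (hx : 1 < x)
    (hr : r ∈ Ioc (0 : ℝ) 1) : Rm x < r ↔ K r < x := by
  obtain ⟨h0, h1, h2⟩ := h x hx
  have := strictAntiOn_K.lt_iff_gt hr ⟨h0, h1.le⟩
  rw [h2] at this
  exact this.symm

lemma IsUpperBranch.lt_iff (h : IsUpperBranch Rp) {x r : ℝ} (hx : 1 < x) (hr : 1 ≤ r) :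
    r < Rp x ↔ K r < x := by
  obtain ⟨h1, h2⟩ := h x hx
  have := strictMonoOn_K.lt_iff_lt (a := r) (b := Rp x) hr h1.le
  rw [h2] at this
  exact this.symm

lemma IsUpperBranch.lt_iff' (h : IsUpperBranch Rp) {x r : ℝ} (hx : 1 < x) (hr : 1 ≤ r) :
    Rp x < r ↔ x < K r := by
  obtain ⟨h1, h2⟩ := h x hx
  have := strictMonoOn_K.lt_iff_lt (a := Rp x) (b := r) h1.le hr
  rw [h2] at this
  exact this.symm

lemma K_le_of_mem_Icc (hm : IsLowerBranch Rm) (hp : IsUpperBranch Rp) {x R : ℝ} (hx : 1 < x)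
    (hR : R ∈ Icc (Rm x) (Rp x)) : K R ≤ x := by
  have h0 := (hm x hx).1
  rcases le_total R 1 with h | h
  · by_contra! hlt
    exact absurd ((hm.lt_iff hx ⟨h0.trans_le hR.1, h⟩).2 hlt) (not_lt.2 hR.1)
  · by_contra! hlt
    exact absurd ((hp.lt_iff' hx h).2 hlt) (not_lt.2 hR.2)

lemma IsLowerBranch.continuousAt (h : IsLowerBranch Rm) {x : ℝ} (hx : 1 < x) :
    ContinuousAt Rm x := by
  have hev : ∀ᶠ y in 𝓝 x, 1 < y := lt_mem_nhds hx
  obtain ⟨h0, h1, -⟩ := h x hx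
  refine tendsto_order.2 ⟨fun a ha => ?_, fun a ha => ?_⟩
  · rcases le_or_gt a 0 with h' | h'
    · filter_upwards [hev] with y hy using h'.trans_lt (h y hy).1
    · have hm : a ∈ Ioc (0 : ℝ) 1 := ⟨h', (ha.trans h1).le⟩
      filter_upwards [hev, gt_mem_nhds ((h.lt_iff hx hm).1 ha)] with y hy hy'
      exact (h.lt_iff hy hm).2 hy'
  · rcases le_or_gt 1 a with h' | h'
    · filter_upwards [hev] with y hy using (h y hy).2.1.trans_le h'
    · have hm : a ∈ Ioc (0 : ℝ) 1 := ⟨h0.trans ha, h'.le⟩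
      filter_upwards [hev, lt_mem_nhds ((h.lt_iff' hx hm).1 ha)] with y hy hy'
      exact (h.lt_iff' hy hm).2 hy'

lemma IsUpperBranch.continuousAt (h : IsUpperBranch Rp) {x : ℝ} (hx : 1 < x) :
    ContinuousAt Rp x := by
  have hev : ∀ᶠ y in 𝓝 x, 1 < y := lt_mem_nhds hx
  obtain ⟨h1, -⟩ := h x hx
  refine tendsto_order.2 ⟨fun a ha => ?_, fun a ha => ?_⟩
  · rcases lt_or_ge a 1 with h' | h'
    · filter_upwards [hev] with y hy using h'.trans (h y hy).1
    · filter_upwards [hev, lt_mem_nhds ((h.lt_iff hx h').1 ha)] with y hy hy'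
      exact (h.lt_iff hy h').2 hy'
  · have h' : 1 ≤ a := (h1.trans ha).le
    filter_upwards [hev, gt_mem_nhds ((h.lt_iff' hx h').1 ha)] with y hy hy'
    exact (h.lt_iff' hy h').2 hy'

lemma IsLowerBranch.continuous_max (h : IsLowerBranch Rm) {b : ℝ} (hb : 1 < b) :
    Continuous fun x => Rm (max x b) :=
  continuous_iff_continuousAt.2 fun x =>
    ContinuousAt.comp' (f := fun x => max x b)
      (h.continuousAt (lt_max_of_lt_right hb)) (by fun_prop)

lemma IsUpperBranch.continuous_max (h : IsUpperBranch Rp) {b : ℝ} (hb : 1 < b) :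
    Continuous fun x => Rp (max x b) :=
  continuous_iff_continuousAt.2 fun x =>
    ContinuousAt.comp' (f := fun x => max x b)
      (h.continuousAt (lt_max_of_lt_right hb)) (by fun_prop)

lemma IsLowerBranch.anti (h : IsLowerBranch Rm) {x y : ℝ} (hx : 1 < x) (hxy : x ≤ y) :
    Rm y ≤ Rm x := by
  obtain ⟨h0, h1, h2⟩ := h x hx
  by_contra! hlt
  have := (h.lt_iff (hx.trans_le hxy) ⟨h0, h1.le⟩).1 hlt
  linarith

/-- `1 - (Rm x)²` is at most `√(2 (x² - 1))`. -/
lemma IsLowerBranch.inv_sqrt_le (h : IsLowerBranch Rm) {x : ℝ} (hx : 1 < x) :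
    (√(2 * (x ^ 2 - 1)))⁻¹ ≤ (1 - Rm x ^ 2)⁻¹ := by
  obtain ⟨h0, h1, h2⟩ := h x hx
  have hexp := exp_eq_of_K_eq h0 h2
  set u := 1 - Rm x ^ 2 with hu
  have hu0 : 0 < u := by nlinarith
  have hu1 : u < 1 := by nlinarith
  have hR : Rm x ^ 2 = 1 - u := by ring
  have e1 : Rm x ^ 2 - 1 = -u := by ring
  rw [e1, hR, exp_neg] at hexp
  have hb : exp u ≤ 1 + u + u ^ 2 / 2 + 2 / 9 * u ^ 3 := by
    have := exp_bound' hu0.le hu1.le (n := 3) (by norm_num)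
    simp [Finset.sum_range_succ, Nat.factorial] at this
    linarith
  have hmul : x ^ 2 * ((1 - u) * exp u) = 1 := by
    rw [← mul_assoc, ← hexp]; exact inv_mul_cancel₀ (exp_pos u).ne'
  have hle : (1 - u) * exp u ≤ 1 - u ^ 2 / 2 := by
    have := mul_le_mul_of_nonneg_left hb (sub_nonneg.2 hu1.le)
    nlinarith [pow_pos hu0 3, pow_pos hu0 4]
  have hx2 : 1 < x ^ 2 := by nlinarith
  have key : u ^ 2 ≤ 2 * (x ^ 2 - 1) := by
    have := mul_le_mul_of_nonneg_left hle (sq_nonneg x)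
    nlinarith [sq_nonneg u]
  exact inv_anti₀ hu0 (le_sqrt_of_sq_le key)

lemma IsUpperBranch.inv_sqrt_le (h : IsUpperBranch Rp) {x : ℝ} (hx : 1 < x) :
    (√(2 * (x ^ 2 - 1)))⁻¹ - 1 / 2 ≤ (Rp x ^ 2 - 1)⁻¹ := by
  obtain ⟨h1, h2⟩ := h x hx
  have hexp := exp_eq_of_K_eq (by linarith) h2
  set v := Rp x ^ 2 - 1 with hv
  have hv0 : 0 < v := by nlinarith
  have hR : Rp x ^ 2 = 1 + v := by ring
  rw [hR] at hexp
  have hx2 : 0 < 2 * (x ^ 2 - 1) := by nlinarith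
  have hb := quadratic_le_exp_of_nonneg hv0.le
  set w := √(2 * (x ^ 2 - 1)) with hw
  have hw0 : 0 < w := sqrt_pos.2 hx2
  have hw2 : w ^ 2 = 2 * (x ^ 2 - 1) := sq_sqrt hx2.le
  have hle : v ≤ w * (1 + v / 2) := by
    apply le_of_sq_le_sq _ (by positivity)
    rw [mul_pow, hw2]
    nlinarith [mul_pos hx2 (pow_pos hv0 2)]
  have : w⁻¹ ≤ v⁻¹ * (1 + v / 2) := by
    rw [inv_eq_one_div, div_le_iff₀ hw0, inv_mul_eq_div, div_mul_eq_mul_div, le_div_iff₀ hv0]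
    linarith
  have e : v⁻¹ * (1 + v / 2) = v⁻¹ + 1 / 2 := by field_simp
  linarith


lemma sqrt_three_div_two_le_sin {ψ : ℝ} (hψ : ψ ∈ Icc (π / 3) (2 * π / 3)) :
    √3 / 2 ≤ sin ψ := by
  rw [← cos_pi_div_six, ← cos_sub_pi_div_two, ← cos_abs (ψ - π / 2)]
  have := pi_pos
  refine cos_le_cos_of_nonneg_of_le_pi (abs_nonneg _) (by linarith) (abs_le.2 ⟨?_, ?_⟩) <;>
    linarith [hψ.1, hψ.2]

lemma one_lt_of_two_div_sqrt_three_lt {c : ℝ} (hc : 2 / √3 < c) : 1 < √3 / 2 * c := by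
  have h3 : 0 < √3 := by positivity
  rw [div_lt_iff₀ h3] at hc
  linarith

lemma mul_sin_mem {c ψ : ℝ} (hc : 0 < c) (hψ : ψ ∈ Icc (π / 3) (2 * π / 3)) :
    √3 / 2 * c ≤ c * sin ψ := by
  nlinarith [sqrt_three_div_two_le_sin hψ]

lemma pi_div_three_le : π / 3 ≤ 2 * π / 3 := by linarith [pi_pos]

lemma continuousOn_lower_integrand (hm : IsLowerBranch Rm) {c : ℝ} (hc : 2 / √3 < c) :
    ContinuousOn (fun ψ => (1 - Rm (c * sin ψ) ^ 2)⁻¹) (Icc (π / 3) (2 * π / 3)) := by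
  have h1 := one_lt_of_two_div_sqrt_three_lt hc
  have hc0 : 0 < c := lt_trans (by positivity) hc
  intro ψ hψ
  have hx : 1 < c * sin ψ := h1.trans_le (mul_sin_mem hc0 hψ)
  obtain ⟨h0, h1, -⟩ := hm _ hx
  have : ContinuousAt (fun ψ => Rm (c * sin ψ)) ψ :=
    ContinuousAt.comp' (f := fun ψ => c * sin ψ) (hm.continuousAt hx) (by fun_prop)
  refine ContinuousAt.continuousWithinAt (ContinuousAt.inv₀ (continuousAt_const.sub (this.pow 2)) ?_)
  nlinarith

lemma continuousOn_upper_integrand (hp : IsUpperBranch Rp) {c : ℝ} (hc : 2 / √3 < c) :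
    ContinuousOn (fun ψ => (Rp (c * sin ψ) ^ 2 - 1)⁻¹) (Icc (π / 3) (2 * π / 3)) := by
  have h1 := one_lt_of_two_div_sqrt_three_lt hc
  have hc0 : 0 < c := lt_trans (by positivity) hc
  intro ψ hψ
  have hx : 1 < c * sin ψ := h1.trans_le (mul_sin_mem hc0 hψ)
  obtain ⟨h1, -⟩ := hp _ hx
  have : ContinuousAt (fun ψ => Rp (c * sin ψ)) ψ :=
    ContinuousAt.comp' (f := fun ψ => c * sin ψ) (hp.continuousAt hx) (by fun_prop)
  refine ContinuousAt.continuousWithinAt (ContinuousAt.inv₀ ((this.pow 2).sub continuousAt_const) ?_)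
  nlinarith

lemma arcsin_le_integral (hm : IsLowerBranch Rm) (hp : IsUpperBranch Rp) {c : ℝ}
    (hc : 2 / √3 < c) :
    2 * √2 / c * arcsin (c / (2 * √(c ^ 2 - 1))) - π / 6 ≤
      (∫ ψ in (π / 3)..(2 * π / 3), (1 - Rm (c * sin ψ) ^ 2)⁻¹) +
        ∫ ψ in (π / 3)..(2 * π / 3), (Rp (c * sin ψ) ^ 2 - 1)⁻¹ := by
  have hb := one_lt_of_two_div_sqrt_three_lt hc
  have hc0 : 0 < c := lt_trans (by positivity) hc
  have hcm := continuousOn_lower_integrand hm hc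
  have hcp := continuousOn_upper_integrand hp hc
  set A := √(c ^ 2 - 1) with hA
  set g : ℝ → ℝ := fun ψ => -(√2 / c * arcsin (c * cos ψ / A)) - ψ / 2 with hg
  have hderiv : ∀ ψ ∈ Icc (π / 3) (2 * π / 3), HasDerivAt g
      (√2 * sin ψ / √((c * sin ψ) ^ 2 - 1) - 1 / 2) ψ := by
    intro ψ hψ
    have hx : 1 < c * sin ψ := hb.trans_le (mul_sin_mem hc0 hψ)
    have hx2 : 0 < (c * sin ψ) ^ 2 - 1 := by nlinarith
    have hcs : (c * sin ψ) ^ 2 - 1 = (c ^ 2 - 1) - (c * cos ψ) ^ 2 := by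
      rw [mul_pow, mul_pow, sin_sq]; ring
    have hc1 : 0 < c ^ 2 - 1 := by nlinarith [sq_nonneg (c * cos ψ)]
    have hA0 : 0 < A := sqrt_pos.2 hc1
    have hA2 : A ^ 2 = c ^ 2 - 1 := sq_sqrt hc1.le
    have hone : 1 - (c * cos ψ / A) ^ 2 = ((c * sin ψ) ^ 2 - 1) / A ^ 2 := by
      rw [hcs, ← hA2]; field_simp
    have hpos : 0 < 1 - (c * cos ψ / A) ^ 2 := by rw [hone]; positivity
    have hd := (((hasDerivAt_arcsin (x := c * cos ψ / A)
      (fun h => by rw [h] at hpos; norm_num at hpos)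
      (fun h => by rw [h] at hpos; norm_num at hpos)).comp ψ
      (((hasDerivAt_cos ψ).const_mul c).div_const A)).const_mul (√2 / c)).neg.sub
      ((hasDerivAt_id' ψ).div_const 2)
    refine hd.congr_deriv ?_
    rw [hone, sqrt_div hx2.le, sqrt_sq hA0.le]
    have : 0 < √((c * sin ψ) ^ 2 - 1) := sqrt_pos.2 hx2
    field_simp
  have hcg : ContinuousOn g (Icc (π / 3) (2 * π / 3)) := HasDerivAt.continuousOn hderiv
  have key := intervalIntegral.sub_le_integral_of_hasDeriv_right_of_le (pi_div_three_le) hcg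
    (fun ψ hψ => (hderiv ψ (Ioo_subset_Icc_self hψ)).hasDerivWithinAt)
    (φ := fun ψ => (1 - Rm (c * sin ψ) ^ 2)⁻¹ + (Rp (c * sin ψ) ^ 2 - 1)⁻¹)
    (hcm.add hcp).integrableOn_Icc ?_
  · rw [intervalIntegral.integral_add (hcm.intervalIntegrable_of_Icc pi_div_three_le)
      (hcp.intervalIntegrable_of_Icc pi_div_three_le)] at key
    refine le_trans (le_of_eq ?_) key
    have e : cos (2 * π / 3) = -(1 / 2) := by
      rw [← cos_pi_div_three, ← cos_pi_sub]; congr 1; ring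
    have e1 : c * (1 / 2) / A = c / (2 * A) := by
      rw [mul_one_div, div_div]
    simp only [hg]
    rw [e, cos_pi_div_three, mul_neg, neg_div, arcsin_neg, e1]
    ring
  · intro ψ hψ
    have hψ' := Ioo_subset_Icc_self hψ
    have hx : 1 < c * sin ψ := hb.trans_le (mul_sin_mem hc0 hψ')
    have hx2 : 0 < (c * sin ψ) ^ 2 - 1 := by nlinarith
    have i1 := hm.inv_sqrt_le hx
    have i2 := hp.inv_sqrt_le hx
    rw [sqrt_mul (by norm_num)] at i1 i2
    have hw : 0 < √((c * sin ψ) ^ 2 - 1) := sqrt_pos.2 hx2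
    have hle : √2 * sin ψ / √((c * sin ψ) ^ 2 - 1) ≤ 2 * (√2 * √((c * sin ψ) ^ 2 - 1))⁻¹ := by
      have e2 : 2 * (√2 * √((c * sin ψ) ^ 2 - 1))⁻¹ = √2 / √((c * sin ψ) ^ 2 - 1) := by
        field_simp
        norm_num
      rw [e2]
      gcongr
      exact mul_le_of_le_one_right (sqrt_nonneg _) (sin_le_one ψ)
    linarith

lemma middle_integral_nonneg (hm : IsLowerBranch Rm) (hp : IsUpperBranch Rp) {c : ℝ}
    (hc : 2 / √3 < c) :
    0 ≤ ∫ R in (Rm (√3 / 2 * c))..(Rp (√3 / 2 * c)), K R / (R * √(c ^ 2 - K R ^ 2)) := by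
  have hb := one_lt_of_two_div_sqrt_three_lt hc
  obtain ⟨h0, h1, -⟩ := hm _ hb
  refine intervalIntegral.integral_nonneg (h1.le.trans (hp _ hb).1.le) fun R hR => ?_
  have hR0 : 0 < R := h0.trans_le hR.1
  have := K_pos hR0
  positivity

lemma exists_lower_bound : ∃ c : ℝ, 2 / √3 < c ∧ c < 2 ∧
    π < 2 * √2 / c * arcsin (c / (2 * √(c ^ 2 - 1))) - π / 6 := by
  have h3 : 0 < √3 := by positivity
  have h33 : √3 ^ 2 = 3 := sq_sqrt (by norm_num)
  have hc1 : (2 / √3) ^ 2 - 1 = (1 / √3) ^ 2 := by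
    rw [div_pow, div_pow, h33]; norm_num
  have hsq : √((2 / √3) ^ 2 - 1) = 1 / √3 := by rw [hc1, sqrt_sq (by positivity)]
  have hcont : ContinuousAt
      (fun c : ℝ => 2 * √2 / c * arcsin (c / (2 * √(c ^ 2 - 1))) - π / 6) (2 / √3) := by
    have d1 : ContinuousAt (fun c : ℝ => c / (2 * √(c ^ 2 - 1))) (2 / √3) := by
      refine ContinuousAt.div (by fun_prop) (by fun_prop) ?_
      rw [hsq]
      positivity
    have d2 := ContinuousAt.comp' (f := fun c : ℝ => c / (2 * √(c ^ 2 - 1)))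
      (continuous_arcsin.continuousAt) d1
    have d3 : ContinuousAt (fun c : ℝ => 2 * √2 / c) (2 / √3) :=
      ContinuousAt.div (by fun_prop) (by fun_prop) (by positivity)
    exact (d3.mul d2).sub continuousAt_const
  have hval : π < 2 * √2 / (2 / √3) * arcsin ((2 / √3) / (2 * √((2 / √3) ^ 2 - 1))) - π / 6 := by
    rw [hsq]
    have e : 2 / √3 / (2 * (1 / √3)) = 1 := by field_simp
    have e' : 2 * √2 / (2 / √3) = √2 * √3 := by field_simp
    rw [e, e', arcsin_one]
    have : 12 / 5 < √2 * √3 := by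
      rw [← sqrt_mul (by norm_num)]
      exact lt_sqrt_of_sq_lt (by norm_num)
    nlinarith [pi_pos]
  have hlt : 2 / √3 < 2 := by
    rw [div_lt_iff₀ h3]
    nlinarith
  have ev1 := (hcont.eventually (lt_mem_nhds hval)).filter_mono
    (nhdsWithin_le_nhds (s := Ioi (2 / √3)))
  have ev2 := (gt_mem_nhds hlt).filter_mono (nhdsWithin_le_nhds (s := Ioi (2 / √3)))
  obtain ⟨c, h, h', h''⟩ := (ev1.and (ev2.and self_mem_nhdsWithin)).exists
  exact ⟨c, h'', h', h⟩


lemma middle_sqrt_bound (hm : IsLowerBranch Rm) (hp : IsUpperBranch Rp) {c R : ℝ}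
    (hc : 2 / √3 < c) (hR : R ∈ Icc (Rm (√3 / 2 * c)) (Rp (√3 / 2 * c))) :
    c ^ 2 / 4 ≤ c ^ 2 - K R ^ 2 := by
  have hb := one_lt_of_two_div_sqrt_three_lt hc
  have hK := K_le_of_mem_Icc hm hp hb hR
  have hK0 := K_pos ((hm _ hb).1.trans_le hR.1)
  have h33 : √3 ^ 2 = 3 := sq_sqrt (by norm_num)
  have : K R ^ 2 ≤ (√3 / 2 * c) ^ 2 := pow_le_pow_left₀ hK0.le hK 2
  rw [mul_pow, div_pow, h33] at this
  linarith

lemma hasDerivWithinAt_K {R : ℝ} (hR : 0 < R) (s : Set ℝ) :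
    HasDerivWithinAt K (K R * (R - R⁻¹)) s R := (hasDerivAt_K hR.ne').hasDerivWithinAt

lemma continuousOn_K_div : ContinuousOn (fun R => K R / R) (Ioi 0) :=
  continuousOn_K.div continuousOn_id fun _ hR => ne_of_gt hR

lemma intervalIntegrable_K_div {a b : ℝ} (ha : 0 < a) (hab : a ≤ b) :
    IntervalIntegrable (fun R => K R / R) MeasureTheory.volume a b :=
  (continuousOn_K_div.mono fun _ h => ha.trans_le h.1).intervalIntegrable_of_Icc hab

lemma integral_K_div_le_of_le_one {a : ℝ} (ha : 0 < a) (ha1 : a ≤ 1) :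
    ∫ R in a..1, K R / R ≤ K a := by
  have hsub : Icc a 1 ⊆ Ioi 0 := fun _ h => ha.trans_le h.1
  have := intervalIntegral.integral_le_sub_of_hasDeriv_right_of_le (g := fun R => R - K R)
    (g' := fun R => 1 - K R * (R - R⁻¹)) (φ := fun R => K R / R) ha1
    (continuousOn_id.sub (continuousOn_K.mono hsub))
    (fun R hR => (hasDerivWithinAt_id R _).sub (hasDerivWithinAt_K (ha.trans hR.1) _))
    (continuousOn_K_div.mono hsub).integrableOn_Icc ?_
  · have h1 : K 1 = 1 := by simp [K]
    rw [h1] at this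
    linarith
  · intro R hR
    have hR0 : 0 < R := ha.trans hR.1
    have hKR : K R * R ≤ 1 := by
      rw [K, div_mul_cancel₀ _ hR0.ne', exp_le_one_iff]
      nlinarith [hR.2]
    have e : K R * (R - R⁻¹) = K R * R - K R / R := by ring
    change K R / R ≤ 1 - K R * (R - R⁻¹)
    linarith

lemma integral_K_div_le_of_one_lt {M b : ℝ} (hM : 1 < M) (hMb : M ≤ b) :
    ∫ R in M..b, K R / R ≤ K b / (M ^ 2 - 1) := by
  have hM0 : 0 < M := by linarith
  have hM2 : 0 < M ^ 2 - 1 := by nlinarith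
  have hsub : Icc M b ⊆ Ioi 0 := fun _ h => hM0.trans_le h.1
  have := intervalIntegral.integral_le_sub_of_hasDeriv_right_of_le
    (g := fun R => K R / (M ^ 2 - 1))
    (g' := fun R => K R * (R - R⁻¹) / (M ^ 2 - 1)) (φ := fun R => K R / R) hMb
    ((continuousOn_K.mono hsub).div_const _)
    (fun R hR => (hasDerivWithinAt_K (hM0.trans hR.1) _).div_const _)
    (continuousOn_K_div.mono hsub).integrableOn_Icc ?_
  · have := div_pos (K_pos hM0) hM2
    linarith
  · intro R hR
    have hR0 : 0 < R := hM0.trans hR.1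
    have hK := K_pos hR0
    have e : K R * (R - R⁻¹) = K R / R * (R ^ 2 - 1) := by field_simp
    rw [e, le_div_iff₀ hM2]
    gcongr
    exact hR.1.le

lemma integral_K_div_le {a M b : ℝ} (ha : 0 < a) (ha1 : a ≤ 1) (hM : 1 < M) (hMb : M ≤ b) :
    ∫ R in a..b, K R / R ≤ K a + K M * (M - 1) + K b / (M ^ 2 - 1) := by
  have h1 := integral_K_div_le_of_le_one ha ha1
  have h3 := integral_K_div_le_of_one_lt hM hMb
  have i1 := intervalIntegrable_K_div ha ha1
  have i2 := intervalIntegrable_K_div one_pos hM.le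
  have i3 := intervalIntegrable_K_div (one_pos.trans hM) hMb
  have h2 : ∫ R in (1 : ℝ)..M, K R / R ≤ K M * (M - 1) := by
    have := intervalIntegral.integral_mono_on hM.le i2 (intervalIntegrable_const (c := K M))
      fun R hR => ?_
    · simpa [mul_comm] using this
    · exact (div_le_self (K_pos (by linarith [hR.1])).le hR.1).trans
        (strictMonoOn_K.monotoneOn hR.1 hM.le hR.2)
  rw [← intervalIntegral.integral_add_adjacent_intervals (i1.trans i2) i3,
    ← intervalIntegral.integral_add_adjacent_intervals i1 i2]
  linarith

lemma middle_integral_le (hm : IsLowerBranch Rm) (hp : IsUpperBranch Rp) {c : ℝ}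
    (hc : 2 / √3 < c) :
    ∫ R in (Rm (√3 / 2 * c))..(Rp (√3 / 2 * c)), K R / (R * √(c ^ 2 - K R ^ 2)) ≤
      2 / c * ∫ R in (Rm (√3 / 2 * c))..(Rp (√3 / 2 * c)), K R / R := by
  have hb := one_lt_of_two_div_sqrt_three_lt hc
  have hc0 : 0 < c := lt_trans (by positivity) hc
  obtain ⟨h0, h1, -⟩ := hm _ hb
  have hle : Rm (√3 / 2 * c) ≤ Rp (√3 / 2 * c) := h1.le.trans (hp _ hb).1.le
  have hsub : Icc (Rm (√3 / 2 * c)) (Rp (√3 / 2 * c)) ⊆ Ioi 0 := fun _ h => h0.trans_le h.1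
  have hK := continuousOn_K.mono hsub
  rw [← intervalIntegral.integral_const_mul]
  refine intervalIntegral.integral_mono_on hle ?_
    ((intervalIntegrable_K_div h0 hle).const_mul _) fun R hR => ?_
  · refine ContinuousOn.intervalIntegrable_of_Icc hle (hK.div
      (continuousOn_id.mul (continuousOn_const.sub (hK.pow 2)).sqrt) fun R hR => ?_)
    have := middle_sqrt_bound hm hp hc hR
    have hR0 : 0 < R := hsub hR
    have : 0 < √(c ^ 2 - K R ^ 2) := sqrt_pos.2 (lt_of_lt_of_le (by positivity) this)
    exact (mul_pos hR0 this).ne'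
  · have hR0 : 0 < R := hsub hR
    have hKR := K_pos hR0
    have hs : c / 2 ≤ √(c ^ 2 - K R ^ 2) := by
      refine le_sqrt_of_sq_le ?_
      have := middle_sqrt_bound hm hp hc hR
      rw [div_pow]
      linarith
    calc K R / (R * √(c ^ 2 - K R ^ 2)) ≤ K R / (R * (c / 2)) := by gcongr
      _ = 2 / c * (K R / R) := by field_simp

lemma exists_upper_bound (hm : IsLowerBranch Rm) (hp : IsUpperBranch Rp) :
    ∃ c : ℝ, 2 ≤ c ∧
      (∫ ψ in (π / 3)..(2 * π / 3), (1 - (Rm (c * sin ψ)) ^ 2)⁻¹) +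
        (∫ R in (Rm (√3 / 2 * c))..(Rp (√3 / 2 * c)), K R / (R * √(c ^ 2 - K R ^ 2))) +
        (∫ ψ in (π / 3)..(2 * π / 3), ((Rp (c * sin ψ)) ^ 2 - 1)⁻¹) < π := by
  have h3 : 0 < √3 := by positivity
  have h33 : √3 ^ 2 = 3 := sq_sqrt (by norm_num)
  have h3l : 1.73 < √3 := lt_sqrt_of_sq_lt (by norm_num)
  have h3u : √3 < 1.7321 := by rw [sqrt_lt' (by norm_num)]; norm_num
  have hK10 : 5 ≤ K 10 := by
    rw [K, le_div_iff₀ (by norm_num)]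
    have := add_one_le_exp ((10 ^ 2 - 1) / 2 : ℝ)
    norm_num at this ⊢
    linarith
  have hK01 : K (1 / 10) ≤ 10 := by
    rw [K, div_le_iff₀ (by norm_num)]
    norm_num
  obtain ⟨c, hcdef⟩ : ∃ c : ℝ, c = 1000 * K 10 := ⟨_, rfl⟩
  have hc2 : 2 ≤ c := by linarith
  have hc : 2 / √3 < c := by
    rw [div_lt_iff₀ h3]
    nlinarith
  have hc0 : 0 < c := by linarith
  have hb := one_lt_of_two_div_sqrt_three_lt hc
  have hbK : 5 / 6 * c < √3 / 2 * c := by nlinarith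
  have hlow : ∀ x, √3 / 2 * c ≤ x → Rm x < 1 / 10 := fun x hx =>
    (hm.lt_iff' (hb.trans_le hx) ⟨by norm_num, by norm_num⟩).2 (by linarith)
  have hupp : ∀ x, √3 / 2 * c ≤ x → 10 < Rp x := fun x hx =>
    (hp.lt_iff (hb.trans_le hx) (by norm_num)).2 (by linarith)
  refine ⟨c, hc2, ?_⟩
  have e1 : ∫ ψ in (π / 3)..(2 * π / 3), (1 - (Rm (c * sin ψ)) ^ 2)⁻¹ ≤ π / 3 * (100 / 99) := by
    have := intervalIntegral.integral_mono_on pi_div_three_le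
      ((continuousOn_lower_integrand hm hc).intervalIntegrable_of_Icc pi_div_three_le)
      (intervalIntegrable_const (μ := MeasureTheory.volume) (c := (100 / 99 : ℝ))) fun ψ hψ => ?_
    · rw [intervalIntegral.integral_const, smul_eq_mul] at this
      linarith
    · have hx := mul_sin_mem hc0 hψ
      have h0 := (hm _ (hb.trans_le hx)).1
      have h1 := hlow _ hx
      refine (inv_anti₀ (b := (99 / 100 : ℝ)) (by norm_num) (by nlinarith)).trans (by norm_num)
  have e3 : ∫ ψ in (π / 3)..(2 * π / 3), ((Rp (c * sin ψ)) ^ 2 - 1)⁻¹ ≤ π / 3 * (1 / 99) := by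
    have := intervalIntegral.integral_mono_on pi_div_three_le
      ((continuousOn_upper_integrand hp hc).intervalIntegrable_of_Icc pi_div_three_le)
      (intervalIntegrable_const (μ := MeasureTheory.volume) (c := (1 / 99 : ℝ))) fun ψ hψ => ?_
    · rw [intervalIntegral.integral_const, smul_eq_mul] at this
      linarith
    · have h1 := hupp _ (mul_sin_mem hc0 hψ)
      refine (inv_anti₀ (b := (99 : ℝ)) (by norm_num) (by nlinarith)).trans (by norm_num)
  obtain ⟨h0, h1, hKm⟩ := hm _ hb
  have e2 := middle_integral_le hm hp hc
  have e4 := integral_K_div_le h0 h1.le (by norm_num : (1 : ℝ) < 10) (hupp _ le_rfl).le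
  rw [hKm, (hp _ hb).2] at e4
  have e5 := mul_le_mul_of_nonneg_left e4 (by positivity : 0 ≤ 2 / c)
  have e6 : 2 / c * (√3 / 2 * c + K 10 * (10 - 1) + √3 / 2 * c / (10 ^ 2 - 1)) =
      √3 * (100 / 99) + 18 / 1000 := by
    have : K 10 = c / 1000 := by linarith
    rw [this]
    field_simp
    ring
  rw [e6] at e5
  linarith [pi_gt_d2]

lemma continuousOn_lower_integral (hm : IsLowerBranch Rm) {c₁ : ℝ} (hc₁ : 2 / √3 < c₁) :
    ContinuousOn (fun c => ∫ ψ in (π / 3)..(2 * π / 3), (1 - (Rm (c * sin ψ)) ^ 2)⁻¹)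
      (Ici c₁) := by
  have hb := one_lt_of_two_div_sqrt_three_lt hc₁
  have hcont : Continuous fun c : ℝ => ∫ ψ in (π / 3)..(2 * π / 3),
      (1 - (Rm (max (c * sin ψ) (√3 / 2 * c₁))) ^ 2)⁻¹ := by
    refine intervalIntegral.continuous_parametric_intervalIntegral_of_continuous' ?_ _ _
    have : Continuous fun p : ℝ × ℝ => Rm (max (p.1 * sin p.2) (√3 / 2 * c₁)) :=
      (hm.continuous_max hb).comp' (f := fun p : ℝ × ℝ => p.1 * sin p.2) (by fun_prop)
    refine (continuous_const.sub (this.pow 2)).inv₀ fun p => ?_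
    obtain ⟨h0, h1, -⟩ := hm _ (lt_max_of_lt_right hb : 1 < max (p.1 * sin p.2) (√3 / 2 * c₁))
    simp only [Pi.sub_apply, Pi.pow_apply]
    nlinarith
  refine hcont.continuousOn.congr fun c (hc : c₁ ≤ c) => ?_
  refine intervalIntegral.integral_congr fun ψ hψ => ?_
  rw [uIcc_of_le pi_div_three_le] at hψ
  have hx := mul_sin_mem (lt_trans (by positivity) (hc₁.trans_le hc)) hψ
  have : √3 / 2 * c₁ ≤ √3 / 2 * c := by gcongr
  simp only [max_eq_left (this.trans hx)]

lemma continuousOn_upper_integral (hp : IsUpperBranch Rp) {c₁ : ℝ} (hc₁ : 2 / √3 < c₁) :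
    ContinuousOn (fun c => ∫ ψ in (π / 3)..(2 * π / 3), ((Rp (c * sin ψ)) ^ 2 - 1)⁻¹)
      (Ici c₁) := by
  have hb := one_lt_of_two_div_sqrt_three_lt hc₁
  have hcont : Continuous fun c : ℝ => ∫ ψ in (π / 3)..(2 * π / 3),
      ((Rp (max (c * sin ψ) (√3 / 2 * c₁))) ^ 2 - 1)⁻¹ := by
    refine intervalIntegral.continuous_parametric_intervalIntegral_of_continuous' ?_ _ _
    have : Continuous fun p : ℝ × ℝ => Rp (max (p.1 * sin p.2) (√3 / 2 * c₁)) :=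
      (hp.continuous_max hb).comp' (f := fun p : ℝ × ℝ => p.1 * sin p.2) (by fun_prop)
    refine ((this.pow 2).sub continuous_const).inv₀ fun p => ?_
    have h1 := (hp _ (lt_max_of_lt_right hb : 1 < max (p.1 * sin p.2) (√3 / 2 * c₁))).1
    simp only [Pi.sub_apply, Pi.pow_apply]
    nlinarith
  refine hcont.continuousOn.congr fun c (hc : c₁ ≤ c) => ?_
  refine intervalIntegral.integral_congr fun ψ hψ => ?_
  rw [uIcc_of_le pi_div_three_le] at hψ
  have hx := mul_sin_mem (lt_trans (by positivity) (hc₁.trans_le hc)) hψ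
  have : √3 / 2 * c₁ ≤ √3 / 2 * c := by gcongr
  simp only [max_eq_left (this.trans hx)]

lemma continuousOn_middle_integral (hm : IsLowerBranch Rm) (hp : IsUpperBranch Rp) {c₁ c₂ : ℝ}
    (hc₁ : 2 / √3 < c₁) :
    ContinuousOn (fun c => ∫ R in (Rm (√3 / 2 * c))..(Rp (√3 / 2 * c)),
      K R / (R * √(c ^ 2 - K R ^ 2))) (Icc c₁ c₂) := by
  rcases lt_or_ge c₂ c₁ with h12 | h12
  · rw [Icc_eq_empty (not_le.2 h12)]
    exact continuousOn_empty _
  have hb := one_lt_of_two_div_sqrt_three_lt hc₁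
  have hb₂ := one_lt_of_two_div_sqrt_three_lt (hc₁.trans_le h12)
  have hc₁0 : 0 < c₁ := lt_trans (by positivity) hc₁
  set r := Rm (√3 / 2 * c₂) with hr
  have hr0 : 0 < r := (hm _ hb₂).1
  set f : ℝ → ℝ → ℝ := fun c R =>
    K (max R r) / (max R r * √(max (c ^ 2 - K (max R r) ^ 2) (c₁ ^ 2 / 4))) with hf
  have hKr : Continuous fun R => K (max R r) := by
    refine continuousOn_K.comp_continuous (f := fun R => max R r) (by fun_prop) fun R => ?_
    exact lt_max_of_lt_right hr0
  have hfc : Continuous f.uncurry := by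
    have hK2 : Continuous fun p : ℝ × ℝ => K (max p.2 r) := hKr.comp' continuous_snd
    refine hK2.div (by fun_prop) fun p => ?_
    have h1 : 0 < max p.2 r := lt_max_of_lt_right hr0
    have h2 : 0 < √(max (p.1 ^ 2 - K (max p.2 r) ^ 2) (c₁ ^ 2 / 4)) :=
      sqrt_pos.2 (lt_max_of_lt_right (by positivity))
    positivity
  have hmc : Continuous fun c => Rm (max (√3 / 2 * c) (√3 / 2 * c₁)) :=
    (hm.continuous_max hb).comp' (f := fun c : ℝ => √3 / 2 * c) (by fun_prop)
  have hpc : Continuous fun c => Rp (max (√3 / 2 * c) (√3 / 2 * c₁)) :=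
    (hp.continuous_max hb).comp' (f := fun c : ℝ => √3 / 2 * c) (by fun_prop)
  have hcont := (intervalIntegral.continuous_parametric_intervalIntegral_of_continuous
    (a₀ := 1) (μ := MeasureTheory.volume) hfc hpc).sub
    (intervalIntegral.continuous_parametric_intervalIntegral_of_continuous
    (a₀ := 1) (μ := MeasureTheory.volume) hfc hmc)
  refine hcont.continuousOn.congr fun c hc => ?_
  have hcc : 2 / √3 < c := hc₁.trans_le hc.1
  have hbc := one_lt_of_two_div_sqrt_three_lt hcc
  have hle : √3 / 2 * c₁ ≤ √3 / 2 * c := by have := hc.1; gcongr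
  have hle₂ : √3 / 2 * c ≤ √3 / 2 * c₂ := by have := hc.2; gcongr
  have hfi : ∀ a b, IntervalIntegrable (f c) MeasureTheory.volume a b :=
    (hfc.comp (Continuous.prodMk_right c)).intervalIntegrable
  simp only [Pi.sub_apply, max_eq_left hle]
  rw [intervalIntegral.integral_interval_sub_left (hfi _ _) (hfi _ _)]
  refine intervalIntegral.integral_congr fun R hR => ?_
  rw [uIcc_of_le ((hm _ hbc).2.1.le.trans (hp _ hbc).1.le)] at hR
  have hRr : r ≤ R := (hm.anti hbc hle₂).trans hR.1
  have hmax : c₁ ^ 2 / 4 ≤ c ^ 2 - K R ^ 2 := by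
    have := middle_sqrt_bound hm hp hcc hR
    have := pow_le_pow_left₀ hc₁0.le hc.1 2
    linarith
  simp only [hf, max_eq_left hRr, max_eq_left hmax]

end Branches

theorem stmt_17 (Rm Rp : ℝ → ℝ)
    (hRm : ∀ x : ℝ, 1 < x → 0 < Rm x ∧ Rm x < 1 ∧ K (Rm x) = x)
    (hRp : ∀ x : ℝ, 1 < x → 1 < Rp x ∧ K (Rp x) = x)
    (hRm1 : Rm 1 = 1) (hRp1 : Rp 1 = 1) :
    ∃ c : ℝ, 2 / Real.sqrt 3 < c ∧
      (∫ ψ in (π / 3)..(2 * π / 3), (1 - (Rm (c * Real.sin ψ)) ^ 2)⁻¹) +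
        (∫ R in (Rm (Real.sqrt 3 / 2 * c))..(Rp (Real.sqrt 3 / 2 * c)),
          K R / (R * Real.sqrt (c ^ 2 - (K R) ^ 2))) +
        (∫ ψ in (π / 3)..(2 * π / 3), ((Rp (c * Real.sin ψ)) ^ 2 - 1)⁻¹) = π := by
  obtain ⟨c₁, hc₁, hc₁2, hlo⟩ := exists_lower_bound
  obtain ⟨c₂, hc₂, hup⟩ := exists_upper_bound hRm hRp
  have h1 := arcsin_le_integral hRm hRp hc₁
  have h2 := middle_integral_nonneg hRm hRp hc₁
  have hcont := (((continuousOn_lower_integral hRm hc₁).mono Icc_subset_Ici_self).add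
    (continuousOn_middle_integral (c₂ := c₂) hRm hRp hc₁)).add
    ((continuousOn_upper_integral hRp hc₁).mono Icc_subset_Ici_self)
  obtain ⟨c, hc, hcπ⟩ := intermediate_value_Icc' (hc₁2.le.trans hc₂) hcont
    ⟨hup.le, by simp only [Pi.add_apply]; linarith⟩
  exact ⟨c, hc₁.trans_le hc.1, hcπ⟩
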